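/- Let (X_t)_{t≥0} be an ergodic (irreducible, aperiodic, positive recurrent) stationary Markov chain on a countable state space with transition matrix P and stationary distribution π, and fix a state i with π_i > 0. Let T_{π,i} = inf{t ≥ 0 : X_t = i} be the first hitting time of i when X_0 ~ π, and let P^{(n)}_{i,i} denote the n-step transition probability from i to i. Then d_K(L(π_i T_{π,i}), Exp(1)) ≤ 2 π_i + Σ_{n=1}^∞ |P^{(n)}_{i,i} − π_i|. -/

import Mathlib

open MeasureTheory ProbabilityTheory Set

noncomputable section

/-- The Kolmogorov distance between two measures on `ℝ`. -/
def dK (P Q : Measure ℝ) : ℝ :=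
  ⨆ z : ℝ, |(P (Iic z)).toReal - (Q (Iic z)).toReal|

open Classical in
/-- `n`-step transition probabilities associated with a transition matrix `P`. -/
def matPow {S : Type*} (P : S → S → ℝ) : ℕ → S → S → ℝ
  | 0 => fun s t => if s = t then 1 else 0
  | (n + 1) => fun s t => ∑' u : S, matPow P n s u * P u t

/-- `X` is a (time homogeneous) Markov chain with transition matrix `P`:
all cylinder events based on singletons are measurable, and the conditional
probability of `{X (n+1) = j}` given the past, on any cylinder event, is `P (X n) j`. -/
def IsMarkovChain {S Ω : Type*} [MeasurableSpace Ω] (μ : Measure Ω)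
    (X : ℕ → Ω → S) (P : S → S → ℝ) : Prop :=
  (∀ n (j : S), MeasurableSet {ω | X n ω = j}) ∧
  ∀ (n : ℕ) (s : ℕ → S) (j : S),
    μ ({ω | ∀ k ≤ n, X k ω = s k} ∩ {ω | X (n + 1) ω = j})
      = ENNReal.ofReal (P (s n) j) * μ {ω | ∀ k ≤ n, X k ω = s k}

/-- Renewal identity `∑ u_j F_{n-j} = 1` rewritten as a comparison of `F` and `H`. -/
lemma renewal_sub_eq_sum {p : ℝ} {u F H : ℕ → ℝ} (hu0 : u 0 = 1) (hH0 : H 0 = 1)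
    (hHF : ∀ n, H n - H (n + 1) = p * F n)
    (hren : ∀ n, ∑ j ∈ Finset.range (n + 1), u j * F (n - j) = 1) (n : ℕ) :
    F n - H (n + 1) = p * F n
      + ∑ j ∈ Finset.range n, (p - u (j + 1)) * F (n - (j + 1)) := by
  have h1 : ∑ j ∈ Finset.range (n + 1), p * F (n - j) = 1 - H (n + 1) := by
    have h := Finset.sum_range_reflect (fun j => p * F j) (n + 1)
    simp only [Nat.add_sub_cancel] at h
    rw [h, ← hH0, ← Finset.sum_range_sub']
    exact Finset.sum_congr rfl fun j _ => (hHF j).symm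
  have h2 := hren n
  rw [Finset.sum_range_succ'] at h1 h2
  simp only [sub_mul, Finset.sum_sub_distrib, Nat.sub_zero, hu0] at h1 h2 ⊢
  linarith

lemma abs_renewal_sub_le {p : ℝ} (hp : 0 < p) {u F H : ℕ → ℝ} (hu0 : u 0 = 1) (hH0 : H 0 = 1)
    (hF0 : ∀ n, 0 ≤ F n) (hF1 : ∀ n, F n ≤ 1)
    (hHF : ∀ n, H n - H (n + 1) = p * F n)
    (hren : ∀ n, ∑ j ∈ Finset.range (n + 1), u j * F (n - j) = 1)
    (hs : Summable fun n => |u (n + 1) - p|) (n : ℕ) :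
    |F n - H (n + 1)| ≤ p + ∑' n, |u (n + 1) - p| := by
  rw [renewal_sub_eq_sum hu0 hH0 hHF hren]
  refine (abs_add_le _ _).trans (add_le_add ?_ ?_)
  · rw [abs_of_nonneg (mul_nonneg hp.le (hF0 n))]
    exact mul_le_of_le_one_right hp.le (hF1 n)
  · refine (Finset.abs_sum_le_sum_abs _ _).trans ?_
    refine le_trans (Finset.sum_le_sum fun j _ => ?_)
      (hs.sum_le_tsum (Finset.range n) fun _ _ => abs_nonneg _)
    rw [abs_mul, abs_of_nonneg (hF0 _), abs_sub_comm]
    exact mul_le_of_le_one_right (abs_nonneg _) (hF1 _)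

lemma tendsto_renewal_tail_zero {p : ℝ} (hp : 0 < p) {u F H : ℕ → ℝ}
    (hu0 : u 0 = 1) (hH0 : H 0 = 1) (hHnn : ∀ n, 0 ≤ H n)
    (hF0 : ∀ n, 0 ≤ F n) (hF1 : ∀ n, F n ≤ 1)
    (hHF : ∀ n, H n - H (n + 1) = p * F n)
    (hren : ∀ n, ∑ j ∈ Finset.range (n + 1), u j * F (n - j) = 1)
    (hs : Summable fun n => |u (n + 1) - p|) :
    Filter.Tendsto H Filter.atTop (nhds 0) := by
  have hFs : Summable F := by
    refine summable_of_sum_range_le (c := 1 / p) hF0 fun n => ?_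
    rw [le_div_iff₀' hp, Finset.mul_sum, ← Finset.sum_congr rfl fun j _ => hHF j,
      Finset.sum_range_sub', hH0]
    linarith [hHnn n]
  have hFt := hFs.tendsto_atTop_zero
  have hconv : Filter.Tendsto
      (fun n => ∑' j, if j < n then (p - u (j + 1)) * F (n - (j + 1)) else 0)
      Filter.atTop (nhds (∑' _ : ℕ, (0 : ℝ))) := by
    refine tendsto_tsum_of_dominated_convergence hs (fun j => ?_)
      (Filter.Eventually.of_forall fun n j => ?_)
    · have h1 : Filter.Tendsto (fun n => (p - u (j + 1)) * F (n - (j + 1)))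
          Filter.atTop (nhds 0) := by
        simpa using ((hFt.comp (Filter.tendsto_sub_atTop_nat (j + 1))).const_mul (p - u (j + 1)))
      refine h1.congr' ?_
      filter_upwards [Filter.eventually_gt_atTop j] with n hn
      rw [if_pos hn]
    · split_ifs
      · rw [Real.norm_eq_abs, abs_mul, abs_of_nonneg (hF0 _), abs_sub_comm]
        exact mul_le_of_le_one_right (abs_nonneg _) (hF1 _)
      · simp
  rw [tsum_zero] at hconv
  have h2 : Filter.Tendsto (fun n => H (n + 1)) Filter.atTop (nhds 0) := by
    have := (hFt.sub (hFt.const_mul p)).sub hconv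
    simp only [mul_zero, sub_zero] at this
    refine this.congr fun n => ?_
    have h3 := renewal_sub_eq_sum hu0 hH0 hHF hren n
    rw [tsum_eq_sum (s := Finset.range n) (by intro b hb; simp at hb; simp [hb]),
      Finset.sum_congr rfl fun j hj => if_pos (Finset.mem_range.mp hj)]
    linarith
  exact (Filter.tendsto_add_atTop_iff_nat 1).mp h2

/-- A perturbed geometric recursion stays close to the geometric sequence. -/
lemma abs_sub_inv_pow_le {p ε : ℝ} (hp : 0 < p) {F H : ℕ → ℝ} (hH0 : H 0 = 1) (hε : 0 ≤ ε)
    (hHF : ∀ n, H n - H (n + 1) = p * F n) (hD : ∀ n, |F n - H (n + 1)| ≤ ε) (n : ℕ) :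
    |H n - ((1 + p) ^ n)⁻¹| ≤ ε := by
  induction n with
  | zero => simpa [hH0] using hε
  | succ n ih =>
    have hq : 0 < 1 + p := by linarith
    have h1 : (1 + p) * (H (n + 1) - ((1 + p) ^ (n + 1))⁻¹)
        = (H n - ((1 + p) ^ n)⁻¹) - p * (F n - H (n + 1)) := by
      have : (1 + p) * ((1 + p) ^ (n + 1))⁻¹ = ((1 + p) ^ n)⁻¹ := by
        rw [pow_succ]; field_simp
      rw [mul_sub, this]
      linarith [hHF n]
    have h2 : (1 + p) * |H (n + 1) - ((1 + p) ^ (n + 1))⁻¹| ≤ (1 + p) * ε := by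
      have habs : (1 + p) * |H (n + 1) - ((1 + p) ^ (n + 1))⁻¹|
          = |(1 + p) * (H (n + 1) - ((1 + p) ^ (n + 1))⁻¹)| := by
        rw [abs_mul, abs_of_pos hq]
      rw [habs, h1]
      refine (abs_sub _ _).trans ?_
      rw [abs_mul, abs_of_pos hp]
      nlinarith [hD n]
    exact le_of_mul_le_mul_left h2 hq

lemma abs_inv_pow_sub_exp_le {p z : ℝ} (hp : 0 < p) (n : ℕ) (h1 : p * n ≤ z)
    (h2 : z ≤ p * (n + 1)) : |((1 + p) ^ (n + 1))⁻¹ - Real.exp (-z)| ≤ p := by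
  have hq : 0 < 1 + p := by linarith
  have hle : Real.exp (-p) ≤ (1 + p)⁻¹ := by
    rw [Real.exp_neg]
    exact inv_anti₀ hq (by linarith [Real.add_one_le_exp p])
  rw [abs_le]
  constructor
  · have h3 : Real.exp (-z) ≤ ((1 + p) ^ n)⁻¹ := by
      calc Real.exp (-z) ≤ Real.exp (n * (-p)) := Real.exp_le_exp.mpr (by linarith)
        _ = Real.exp (-p) ^ n := Real.exp_nat_mul _ _
        _ ≤ ((1 + p)⁻¹) ^ n := pow_le_pow_left₀ (Real.exp_pos _).le hle n
        _ = _ := inv_pow _ _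
    have h4 : ((1 + p) ^ n)⁻¹ - ((1 + p) ^ (n + 1))⁻¹ = p * ((1 + p) ^ (n + 1))⁻¹ := by
      rw [pow_succ]; field_simp; ring
    have h5 : ((1 + p) ^ (n + 1))⁻¹ ≤ 1 := inv_le_one_of_one_le₀ (one_le_pow₀ (by linarith))
    nlinarith
  · have h3 : Real.exp (-p) ^ (n + 1) ≤ Real.exp (-z) := by
      rw [← Real.exp_nat_mul]
      exact Real.exp_le_exp.mpr (by push_cast; linarith)
    have hb : 1 + ((n + 1 : ℕ) : ℝ) * p ≤ (1 + p) ^ (n + 1) :=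
      one_add_mul_le_pow (by linarith) _
    have hd : (1 + p)⁻¹ - Real.exp (-p) ≤ p ^ 2 * (1 + p)⁻¹ := by
      have : (1 + p)⁻¹ - (1 - p) = p ^ 2 * (1 + p)⁻¹ := by field_simp; ring
      linarith [Real.add_one_le_exp (-p)]
    have h6 : ((1 + p)⁻¹) ^ (n + 1) - Real.exp (-p) ^ (n + 1)
        ≤ (n + 1) * ((1 + p)⁻¹ - Real.exp (-p)) * ((1 + p)⁻¹) ^ n := by
      rw [← Commute.geom_sum₂_mul (Commute.all _ _), mul_comm _ ((1 + p)⁻¹ - Real.exp (-p)),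
        mul_comm ((n : ℝ) + 1), mul_assoc]
      refine mul_le_mul_of_nonneg_left ?_ (by linarith)
      have : ∀ j ∈ Finset.range (n + 1), ((1 + p)⁻¹) ^ j * Real.exp (-p) ^ (n + 1 - 1 - j)
          ≤ ((1 + p)⁻¹) ^ n := by
        intro j hj
        have hj' := Finset.mem_range.mp hj
        calc _ ≤ ((1 + p)⁻¹) ^ j * ((1 + p)⁻¹) ^ (n + 1 - 1 - j) := by
              gcongr
          _ = _ := by rw [← pow_add]; congr 1; omega
      simpa using Finset.sum_le_card_nsmul _ _ _ this
    have h7 : (n + 1) * ((1 + p)⁻¹ - Real.exp (-p)) * ((1 + p)⁻¹) ^ n ≤ p := by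
      calc _ ≤ ((n : ℝ) + 1) * (p ^ 2 * (1 + p)⁻¹) * ((1 + p)⁻¹) ^ n := by gcongr
        _ = p * (((n + 1) * p) * ((1 + p) ^ (n + 1))⁻¹) := by
          rw [inv_pow, pow_succ (1 + p) n]; field_simp
        _ ≤ p * 1 := by
          gcongr
          rw [← div_eq_mul_inv, div_le_one (by positivity)]
          push_cast at hb; linarith
        _ = p := mul_one p
    rw [← inv_pow]
    linarith

open Classical in
/-- Probability of avoiding `i` during the next `n` steps, as a function of the current state. -/
def avoidProb {S : Type*} (P : S → S → ℝ) (i : S) : ℕ → S → ENNReal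
  | 0 => fun _ => 1
  | (n + 1) => fun s => ∑' t : S, if t = i then 0 else ENNReal.ofReal (P s t) * avoidProb P i n t

/-- The event that `X` avoids `i` at all times in `[a, b)`. -/
def avoids {S Ω : Type*} (X : ℕ → Ω → S) (i : S) (a b : ℕ) : Set Ω :=
  {ω | ∀ k, a ≤ k → k < b → X k ω ≠ i}

/-- The event `A` depends only on `X 0, …, X m`. -/
def DependsOnPast {S Ω : Type*} (X : ℕ → Ω → S) (m : ℕ) (A : Set Ω) : Prop :=
  ∀ ω ω', (∀ k ≤ m, X k ω = X k ω') → (ω ∈ A ↔ ω' ∈ A)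

lemma DependsOnPast.inter_eq {S Ω : Type*} {X : ℕ → Ω → S} {m : ℕ} {A : Set Ω}
    (hA : DependsOnPast X m A) {k : ℕ} (hk : k ≤ m) (s : S) :
    DependsOnPast X m (A ∩ {ω | X k ω = s}) := by
  intro ω ω' h
  simp only [mem_inter_iff, mem_ofPred_eq, hA ω ω' h, h k hk]

lemma DependsOnPast.mono {S Ω : Type*} {X : ℕ → Ω → S} {m n : ℕ} {A : Set Ω}
    (hA : DependsOnPast X m A) (hmn : m ≤ n) : DependsOnPast X n A :=
  fun ω ω' h => hA ω ω' fun k hk => h k (hk.trans hmn)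

lemma measurableSet_preimage_of_countable {β Ω : Type*} [Countable β] [MeasurableSpace Ω]
    {g : Ω → β} (hg : ∀ b, MeasurableSet {ω | g ω = b}) (C : Set β) :
    MeasurableSet (g ⁻¹' C) := by
  have h : g ⁻¹' C = ⋃ b ∈ C, {ω | g ω = b} := by ext; simp
  rw [h]
  exact MeasurableSet.biUnion C.to_countable fun b _ => hg b

lemma measure_eq_tsum_inter {β Ω : Type*} [Countable β] [MeasurableSpace Ω] (μ : Measure Ω)
    {g : Ω → β} (hg : ∀ b, MeasurableSet {ω | g ω = b}) {A : Set Ω} (hA : MeasurableSet A) :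
    μ A = ∑' b, μ (A ∩ {ω | g ω = b}) := by
  rw [← measure_iUnion _ fun b => hA.inter (hg b)]
  · congr 1; ext; simp
  · intro b c hbc
    refine Set.disjoint_left.mpr ?_
    rintro ω ⟨_, h1⟩ ⟨_, h2⟩
    exact hbc (h1.symm.trans h2)

section Chain

variable {S : Type*} {Ω : Type*} {X : ℕ → Ω → S}

lemma DependsOnPast.eq_preimage_path {m : ℕ} {A : Set Ω} (hA : DependsOnPast X m A) :
    A = (fun ω (k : Fin (m + 1)) => X k ω) ⁻¹' ((fun ω (k : Fin (m + 1)) => X k ω) '' A) := by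
  refine (subset_preimage_image _ _).antisymm ?_
  rintro ω ⟨ω', hω', h⟩
  exact (hA ω' ω fun k hk => congrFun h ⟨k, Nat.lt_succ_of_le hk⟩).mp hω'

variable [MeasurableSpace Ω] {μ : Measure Ω} {P : S → S → ℝ}

lemma measurableSet_path (hX : IsMarkovChain μ X P) (m : ℕ) (b : Fin (m + 1) → S) :
    MeasurableSet {ω | (fun k : Fin (m + 1) => X k ω) = b} := by
  simp only [funext_iff, ← Set.iInter_ofPred]
  exact MeasurableSet.iInter fun k => hX.1 _ _

lemma measurableSet_avoids (hX : IsMarkovChain μ X P) (i : S) (a b : ℕ) :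
    MeasurableSet (avoids X i a b) := by
  have h : avoids X i a b = ⋂ k, ⋂ (_ : a ≤ k), ⋂ (_ : k < b), {ω | X k ω = i}ᶜ := by
    ext; simp [avoids]
  rw [h]
  exact MeasurableSet.iInter fun k => MeasurableSet.iInter fun _ => MeasurableSet.iInter fun _ =>
    (hX.1 k i).compl

lemma measureReal_inter_avoids_succ [IsProbabilityMeasure μ] (hX : IsMarkovChain μ X P) (i : S)
    (A : Set Ω) {j b : ℕ} (hj : j < b) :
    μ.real (A ∩ avoids X i (j + 1) b) =
      μ.real (A ∩ avoids X i j b) + μ.real (A ∩ {ω | X j ω = i} ∩ avoids X i (j + 1) b) := by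
  rw [← measureReal_inter_add_sdiff (μ := μ) (s := A ∩ avoids X i (j + 1) b) (hX.1 j i), add_comm]
  congr 2
  · ext ω
    simp only [mem_sdiff, mem_inter_iff, mem_ofPred_eq, avoids]
    constructor
    · rintro ⟨⟨h1, h2⟩, h3⟩
      refine ⟨h1, fun k hk hk' => ?_⟩
      rcases hk.eq_or_lt with rfl | hlt
      · exact h3
      · exact h2 k hlt hk'
    · rintro ⟨h1, h2⟩
      exact ⟨⟨h1, fun k hk hk' => h2 k (by omega) hk'⟩, h2 j le_rfl hj⟩
  · rw [inter_right_comm]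

variable [Countable S]

lemma DependsOnPast.measurableSet (hX : IsMarkovChain μ X P) {m : ℕ} {A : Set Ω}
    (hA : DependsOnPast X m A) : MeasurableSet A := by
  rw [hA.eq_preimage_path]
  exact measurableSet_preimage_of_countable (measurableSet_path hX m) _

/-- The Markov property for an arbitrary event of the past. -/
lemma DependsOnPast.measure_step (hX : IsMarkovChain μ X P) {m : ℕ} {A : Set Ω}
    (hA : DependsOnPast X m A) (s j : S) :
    μ (A ∩ {ω | X m ω = s} ∩ {ω | X (m + 1) ω = j})
      = μ (A ∩ {ω | X m ω = s}) * ENNReal.ofReal (P s j) := by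
  have hAs := hA.inter_eq le_rfl s
  have hm := hAs.measurableSet hX
  rw [measure_eq_tsum_inter μ (measurableSet_path hX m) (hm.inter (hX.1 _ _)),
    measure_eq_tsum_inter μ (measurableSet_path hX m) hm, ← ENNReal.tsum_mul_right]
  congr 1 with b
  by_cases hne : (A ∩ {ω | X m ω = s} ∩ {ω | (fun k : Fin (m + 1) => X k ω) = b}).Nonempty
  · obtain ⟨ω₀, ⟨h0A, h0s⟩, h0b⟩ := hne
    have h1 : A ∩ {ω | X m ω = s} ∩ {ω | (fun k : Fin (m + 1) => X k ω) = b}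
        = {ω | ∀ k ≤ m, X k ω = X k ω₀} := by
      ext ω
      constructor
      · rintro ⟨_, hb⟩ k hk
        exact congrFun (hb.trans h0b.symm) (⟨k, Nat.lt_succ_of_le hk⟩ : Fin (m + 1))
      · intro h
        refine ⟨(hAs ω ω₀ h).mpr ⟨h0A, h0s⟩, ?_⟩
        exact (funext fun k : Fin (m + 1) => h k (Nat.le_of_lt_succ k.2)).trans h0b
    have h0s' : X m ω₀ = s := h0s
    rw [inter_right_comm, h1, hX.2 m (fun k => X k ω₀) j, h0s', mul_comm]
  · rw [not_nonempty_iff_eq_empty] at hne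
    rw [inter_right_comm, hne]
    simp

lemma DependsOnPast.measure_avoids (hX : IsMarkovChain μ X P) (i : S) (n : ℕ) {m : ℕ} {A : Set Ω}
    (hA : DependsOnPast X m A) (s : S) :
    μ (A ∩ {ω | X m ω = s} ∩ avoids X i (m + 1) (m + 1 + n))
      = μ (A ∩ {ω | X m ω = s}) * avoidProb P i n s := by
  induction n generalizing m A s with
  | zero =>
    have : avoids X i (m + 1) (m + 1 + 0) = univ := by
      ext; simp only [avoids, mem_ofPred_eq, mem_univ, iff_true]; intros; omega
    simp [this, avoidProb]
  | succ n ih =>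
    have hAs := hA.inter_eq le_rfl s
    rw [measure_eq_tsum_inter μ (hX.1 (m + 1))
      ((hAs.measurableSet hX).inter (measurableSet_avoids hX i _ _)), avoidProb,
      ← ENNReal.tsum_mul_left]
    congr 1 with t
    by_cases ht : t = i
    · rw [if_pos ht, mul_zero]
      convert measure_empty (μ := μ)
      rw [eq_empty_iff_forall_notMem]
      rintro ω ⟨⟨_, h1⟩, h2⟩
      exact h1 (m + 1) le_rfl (by omega) (ht ▸ h2)
    · rw [if_neg ht, ← mul_assoc, ← hA.measure_step hX, ← ih (hAs.mono m.le_succ)]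
      congr 1
      ext ω
      simp only [mem_inter_iff, mem_ofPred_eq, avoids]
      constructor
      · rintro ⟨⟨h1, h2⟩, h3⟩
        exact ⟨⟨h1, h3⟩, fun k hk hk' => h2 k (by omega) (by omega)⟩
      · rintro ⟨⟨h1, h3⟩, h2⟩
        refine ⟨⟨h1, fun k hk hk' => ?_⟩, h3⟩
        rcases hk.eq_or_lt with rfl | hlt
        · rwa [h3]
        · exact h2 k hlt (by omega)

lemma measureReal_start_inter_eq [IsProbabilityMeasure μ] (hPnonneg : ∀ s t, 0 ≤ P s t)
    (hX : IsMarkovChain μ X P) (i : S) (n : ℕ) (t : S) :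
    μ.real ({ω | X 0 ω = i} ∩ {ω | X n ω = t}) = μ.real {ω | X 0 ω = i} * matPow P n i t := by
  have hdep (k : ℕ) : DependsOnPast X k {ω | X 0 ω = i} := fun ω ω' h => by
    simp [h 0 (Nat.zero_le _)]
  induction n generalizing t with
  | zero =>
    by_cases hit : i = t
    · simp [matPow, hit]
    · have : {ω | X 0 ω = i} ∩ {ω | X 0 ω = t} = ∅ := by
        rw [eq_empty_iff_forall_notMem]
        rintro ω ⟨h1, h2⟩
        exact hit (h1.symm.trans h2)
      simp [matPow, hit, this]
  | succ n ih =>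
    rw [matPow, ← tsum_mul_left, Measure.real,
      measure_eq_tsum_inter μ (hX.1 n) ((hX.1 0 i).inter (hX.1 _ t)),
      ENNReal.tsum_toReal_eq fun _ => measure_ne_top _ _]
    congr 1 with s
    rw [inter_right_comm, (hdep n).measure_step hX, ENNReal.toReal_mul,
      ENNReal.toReal_ofReal (hPnonneg _ _), ← mul_assoc, ← ih, Measure.real]

open Classical in
lemma measure_avoids_eq_tsum (hX : IsMarkovChain μ X P) (i : S) (m n : ℕ) :
    μ (avoids X i m (m + 1 + n))
      = ∑' s, if s = i then 0 else μ {ω | X m ω = s} * avoidProb P i n s := by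
  rw [measure_eq_tsum_inter μ (hX.1 m) (measurableSet_avoids hX i _ _)]
  congr 1 with s
  split_ifs with hs
  · convert measure_empty (μ := μ)
    rw [eq_empty_iff_forall_notMem]
    rintro ω ⟨h1, h2⟩
    exact h1 m le_rfl (by omega) (hs ▸ h2)
  · have hdep : DependsOnPast X m (univ : Set Ω) := fun _ _ _ => by simp
    have h := hdep.measure_avoids hX i n s
    rw [univ_inter] at h
    rw [← h]
    congr 1
    ext ω
    simp only [mem_inter_iff, mem_ofPred_eq, avoids]
    constructor
    · rintro ⟨h1, h2⟩
      exact ⟨h2, fun k hk hk' => h1 k (by omega) hk'⟩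
    · rintro ⟨h2, h1⟩
      refine ⟨fun k hk hk' => ?_, h2⟩
      rcases hk.eq_or_lt with rfl | hlt
      · rwa [h2]
      · exact h1 k hlt hk'

/-- A stationary chain avoids `i` with the same probability on all windows of a given length. -/
lemma measure_avoids_shift {π : S → ℝ} (hX : IsMarkovChain μ X P)
    (hXstat : ∀ (t : ℕ) (j : S), μ {ω | X t ω = j} = ENNReal.ofReal (π j)) (i : S) (m n : ℕ) :
    μ (avoids X i m (m + n)) = μ (avoids X i 0 n) := by
  cases n with
  | zero =>
    congr 1
    ext
    simp only [avoids, mem_ofPred_eq]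
    exact ⟨fun _ _ _ _ => by omega, fun _ _ _ _ => by omega⟩
  | succ n =>
    have h1 := measure_avoids_eq_tsum hX i m n
    have h2 := measure_avoids_eq_tsum hX i 0 n
    simp only [hXstat] at h1 h2
    rw [show m + (n + 1) = m + 1 + n by omega, h1, ← h2, show n + 1 = 0 + 1 + n by omega]

end Chain

theorem kolmogorov_bound_hitting_time_transition_probabilities
    {S : Type*} [Countable S]
    {Ω : Type*} [MeasurableSpace Ω] (μ : Measure Ω) [IsProbabilityMeasure μ]
    (P : S → S → ℝ) (π : S → ℝ) (i : S)
    -- `P` is a stochastic matrix: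
    (hPnonneg : ∀ s t, 0 ≤ P s t) (hProw : ∀ s, HasSum (P s) 1)
    -- `π` is a stationary probability distribution (this, together with
    -- irreducibility, expresses positive recurrence):
    (hπnonneg : ∀ s, 0 ≤ π s) (hπsum : HasSum π 1)
    (hπstat : ∀ t, HasSum (fun s => π s * P s t) (π t))
    (hπi : 0 < π i)
    -- the chain is irreducible and aperiodic:
    (hirr : ∀ s t : S, ∃ n : ℕ, 0 < n ∧ 0 < matPow P n s t)
    (haper : ∀ s : S, ∃ N₀ : ℕ, ∀ n ≥ N₀, 0 < matPow P n s s)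
    -- `X` is a stationary Markov chain with transition matrix `P`:
    (X : ℕ → Ω → S) (hX : IsMarkovChain μ X P)
    (hXstat : ∀ (t : ℕ) (j : S), μ {ω | X t ω = j} = ENNReal.ofReal (π j))
    -- the hitting time of `i` for the stationary chain:
    (Tπ : Ω → ℕ)
    (hTπ : ∀ ω, Tπ ω = sInf {t : ℕ | X t ω = i}) :
    ENNReal.ofReal (dK (Measure.map (fun ω => π i * (Tπ ω : ℝ)) μ) (expMeasure 1))
      ≤ ENNReal.ofReal (2 * π i)
        + ∑' n : ℕ, ENNReal.ofReal |matPow P (n + 1) i i - π i| := by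
  by_cases htop : ∑' n : ℕ, ENNReal.ofReal |matPow P (n + 1) i i - π i| = ⊤
  · simp [htop]
  have hs : Summable fun n => |matPow P (n + 1) i i - π i| := by
    have h := ENNReal.summable_toReal htop
    simpa only [ENNReal.toReal_ofReal (abs_nonneg _)] using h
  rw [← ENNReal.ofReal_tsum_of_nonneg (fun _ => abs_nonneg _) hs,
    ← ENNReal.ofReal_add (by positivity) (tsum_nonneg fun _ => abs_nonneg _)]
  refine ENNReal.ofReal_le_ofReal ?_
  set u : ℕ → ℝ := fun n => matPow P n i i with hu
  set F : ℕ → ℝ := fun n => (avoidProb P i n i).toReal with hF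
  set H : ℕ → ℝ := fun n => μ.real (avoids X i 0 n) with hH
  have hstart : μ.real {ω | X 0 ω = i} = π i := by
    rw [Measure.real, hXstat, ENNReal.toReal_ofReal hπi.le]
  have hdep (k : ℕ) : DependsOnPast X k {ω | X 0 ω = i} := fun ω ω' h => by
    simp [h 0 (Nat.zero_le _)]
  have hreturn (n : ℕ) : μ.real ({ω | X 0 ω = i} ∩ avoids X i 1 (1 + n)) = π i * F n := by
    have hdep' : DependsOnPast X 0 (univ : Set Ω) := fun _ _ _ => by simp
    have h := hdep'.measure_avoids hX i n i
    rw [univ_inter, zero_add] at h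
    rw [Measure.real, h, ENNReal.toReal_mul, ← Measure.real, hstart]
  have hterm (n j : ℕ) (hj : j ≤ n) :
      μ.real ({ω | X 0 ω = i} ∩ {ω | X j ω = i} ∩ avoids X i (j + 1) (n + 1))
        = π i * (u j * F (n - j)) := by
    have h := (hdep j).measure_avoids hX i (n - j) i
    rw [show j + 1 + (n - j) = n + 1 by omega] at h
    rw [Measure.real, h, ENNReal.toReal_mul, ← Measure.real,
      measureReal_start_inter_eq hPnonneg hX, hstart, mul_assoc]
  have hu0 : u 0 = 1 := by simp [hu, matPow]
  have hH0 : H 0 = 1 := by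
    have : avoids X i 0 0 = univ := by ext; simp [avoids]
    simp [hH, this]
  have hF0 (n : ℕ) : 0 ≤ F n := ENNReal.toReal_nonneg
  have hF1 (n : ℕ) : F n ≤ 1 := by
    have h : π i * F n ≤ π i := by
      rw [← hreturn]
      exact (measureReal_mono inter_subset_left).trans_eq hstart
    exact le_of_mul_le_mul_left (by linarith) hπi
  have hHF (n : ℕ) : H n - H (n + 1) = π i * F n := by
    have h := measureReal_inter_avoids_succ hX i univ (j := 0) (b := 1 + n) (by omega)
    simp only [univ_inter, zero_add] at h
    have h1 : μ.real (avoids X i 1 (1 + n)) = H n :=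
      congrArg ENNReal.toReal (measure_avoids_shift hX hXstat i 1 n)
    rw [hreturn, h1, add_comm 1 n] at h
    linarith
  have hren (n : ℕ) : ∑ j ∈ Finset.range (n + 1), u j * F (n - j) = 1 := by
    have h : π i * ∑ j ∈ Finset.range (n + 1), u j * F (n - j) = π i := by
      rw [Finset.mul_sum]
      have hsum : ∀ j ∈ Finset.range (n + 1), π i * (u j * F (n - j))
          = μ.real ({ω | X 0 ω = i} ∩ avoids X i (j + 1) (n + 1))
            - μ.real ({ω | X 0 ω = i} ∩ avoids X i j (n + 1)) := by
        intro j hj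
        have hj' := Finset.mem_range.mp hj
        rw [← hterm n j (by omega), measureReal_inter_avoids_succ hX i {ω | X 0 ω = i} hj']
        ring
      rw [Finset.sum_congr rfl hsum,
        Finset.sum_range_sub fun j => μ.real ({ω | X 0 ω = i} ∩ avoids X i j (n + 1))]
      have h1 : avoids X i (n + 1) (n + 1) = univ := by
        ext
        simp only [avoids, mem_ofPred_eq, mem_univ, iff_true]
        intros
        omega
      have h2 : {ω | X 0 ω = i} ∩ avoids X i 0 (n + 1) = ∅ := by
        rw [eq_empty_iff_forall_notMem]
        rintro ω ⟨h1, h2⟩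
        exact h2 0 le_rfl n.succ_pos h1
      rw [h1, h2, inter_univ, measureReal_empty, hstart, sub_zero]
    exact mul_left_cancel₀ hπi.ne' (by rw [h, mul_one])
  have hHt := tendsto_renewal_tail_zero hπi hu0 hH0 (fun _ => measureReal_nonneg) hF0 hF1 hHF hren hs
  have hsnn : 0 ≤ ∑' n, |u (n + 1) - π i| := tsum_nonneg fun _ => abs_nonneg _
  have hmain := abs_sub_inv_pow_le hπi hH0 (by positivity) hHF
    (abs_renewal_sub_le hπi hu0 hH0 hF0 hF1 hHF hren hs)
  have hhit : ∀ᵐ ω ∂μ, ∃ k, X k ω = i := by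
    have hnull : μ.real {ω | ¬ ∃ k, X k ω = i} = 0 := by
      refine le_antisymm (ge_of_tendsto' hHt fun n => measureReal_mono ?_) measureReal_nonneg
      intro ω hω k _ _ hk
      exact hω ⟨k, hk⟩
    exact (measureReal_eq_zero_iff).mp hnull
  have hTiff (n : ℕ) (ω : Ω) (hω : ∃ k, X k ω = i) :
      Tπ ω ≤ n ↔ ω ∈ (avoids X i 0 (n + 1))ᶜ := by
    change Tπ ω ≤ n ↔ ¬ ∀ k, 0 ≤ k → k < n + 1 → X k ω ≠ i
    rw [hTπ]
    constructor
    · intro h hall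
      exact hall _ (Nat.zero_le _) (Nat.lt_succ_of_le h) (Nat.sInf_mem (s := {t | X t ω = i}) hω)
    · intro h
      push Not at h
      obtain ⟨k, -, hk, hki⟩ := h
      exact (Nat.sInf_le (s := {t | X t ω = i}) hki).trans (Nat.le_of_lt_succ hk)
  have hTmeas : Measurable Tπ := by
    refine measurable_of_Iic fun n => ?_
    have hpre : Tπ ⁻¹' Iic n = (avoids X i 0 (n + 1))ᶜ ∪ ⋂ k, {ω | X k ω = i}ᶜ := by
      ext ω
      by_cases hω : ∃ k, X k ω = i
      · have hmem : ω ∉ ⋂ k, {ω | X k ω = i}ᶜ := by simpa using hω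
        rw [mem_union, or_iff_left hmem, ← hTiff n ω hω, mem_preimage, mem_Iic]
      · have hmem : ω ∈ ⋂ k, {ω | X k ω = i}ᶜ := by simpa using hω
        have hempty : {t | X t ω = i} = ∅ :=
          eq_empty_iff_forall_notMem.mpr fun k hk => hω ⟨k, hk⟩
        simp only [mem_union, hmem, or_true, mem_preimage, mem_Iic, hTπ, hempty,
          Nat.sInf_empty, Nat.zero_le]
    rw [hpre]
    exact (measurableSet_avoids hX i _ _).compl.union
      (MeasurableSet.iInter fun k => (hX.1 k i).compl)
  have hTle (n : ℕ) : μ.real {ω | Tπ ω ≤ n} = 1 - H (n + 1) := by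
    rw [hH, ← probReal_compl_eq_one_sub (measurableSet_avoids hX i _ _)]
    refine measureReal_congr ?_
    filter_upwards [hhit] with ω hω
    exact propext (hTiff n ω hω)
  have hexp (z : ℝ) : (expMeasure 1 (Iic z)).toReal = if 0 ≤ z then 1 - Real.exp (-z) else 0 := by
    have := isProbabilityMeasure_expMeasure (r := 1) one_pos
    have h := cdf_expMeasure_eq (r := 1) one_pos z
    rw [cdf_eq_real] at h
    simpa [Measure.real] using h
  refine ciSup_le fun z => ?_
  have hmap : Measurable fun ω => π i * (Tπ ω : ℝ) :=
    (measurable_from_top.comp hTmeas).const_mul _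
  rw [hexp, Measure.map_apply hmap measurableSet_Iic]
  split_ifs with hz
  · set n := ⌊z / π i⌋₊ with hn
    have hset : (fun ω => π i * (Tπ ω : ℝ)) ⁻¹' Iic z = {ω | Tπ ω ≤ n} := by
      ext ω
      simp only [mem_preimage, mem_Iic, mem_ofPred_eq]
      rw [hn, Nat.le_floor_iff (by positivity), le_div_iff₀' hπi]
    have h1 : π i * n ≤ z := by
      rw [← le_div_iff₀' hπi]
      exact Nat.floor_le (by positivity)
    have h2 : z ≤ π i * (n + 1) := by
      rw [← div_le_iff₀' hπi]
      exact (Nat.lt_floor_add_one _).le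
    have h3 := abs_inv_pow_sub_exp_le hπi n h1 h2
    have h4 := hmain (n + 1)
    rw [hset, ← Measure.real, hTle]
    rw [abs_le] at h3 h4 ⊢
    constructor <;> linarith [h3.1, h3.2, h4.1, h4.2]
  · have hset : (fun ω => π i * (Tπ ω : ℝ)) ⁻¹' Iic z = ∅ := by
      rw [eq_empty_iff_forall_notMem]
      intro ω hω
      exact hz (le_trans (by positivity) hω)
    rw [hset]
    simp only [measure_empty, ENNReal.toReal_zero, sub_zero, abs_zero]
    positivity

end
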